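/- Advanced group privacy for P-PRzCDP (Lemma 5): Let T be a record set, P : T → [0,∞) a policy function, and let M be a mechanism satisfying P-PRzCDP. Let J ≥ 1 and let D₀, D₁, …, D_J be databases over T such that for each j ∈ {1,…,J}, D_j and D_{j−1} differ in the record r_j. Let r_(1), …, r_(J) be a reordering (permutation) of r_1, …, r_J such that P(r_(1)) ≥ P(r_(2)) ≥ ⋯ ≥ P(r_(J)). Then for all α ∈ (1,∞), D_α(M(D₀)‖M(D_J)) ≤ α · inf_{k ∈ (1,∞)} Σ_{j=1}^{J} (k^j / (k−1)) · P(r_(j)). -/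

import Mathlib

open MeasureTheory ProbabilityTheory
open scoped Classical NNReal

/-- Rényi divergence of order `α` between two measures. -/
noncomputable def renyiDiv {X : Type*} [MeasurableSpace X] (α : ℝ) (P Q : Measure X) : EReal :=
  if P ≪ Q then (((α - 1)⁻¹ : ℝ) : EReal) * ENNReal.log (∫⁻ x, P.rnDeriv Q x ^ α ∂Q)
  else ⊤

/-- Databases `D` and `D'` differ in the single record `r`. -/
def Neighbors {T : Type*} (D D' : Multiset T) (r : T) : Prop :=
  D' = r ::ₘ D ∨ D = r ::ₘ D'

/-- Per-record zero-concentrated differential privacy with policy function `P`. -/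
def PRzCDP {T Y : Type*} [MeasurableSpace Y] (M : Multiset T → Measure Y) (P : T → ℝ) : Prop :=
  ∀ α : ℝ, 1 < α → ∀ (D D' : Multiset T) (r : T), Neighbors D D' r →
    renyiDiv α (M D) (M D') ≤ ((α * P r : ℝ) : EReal)

/-- Zero-concentrated differential privacy with privacy-loss parameter `ρ`. -/
def zCDP {T Y : Type*} [MeasurableSpace Y] (M : Multiset T → Measure Y) (ρ : ℝ) : Prop :=
  ∀ α : ℝ, 1 < α → ∀ (D D' : Multiset T) (r : T), Neighbors D D' r →
    renyiDiv α (M D) (M D') ≤ ((ρ * α : ℝ) : EReal)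

/-- `NeighborPath D L D'` holds if `D'` arises from `D` by successively adding or removing one copy
of each record in `L`, in this order. -/
inductive NeighborPath {T : Type*} : Multiset T → List T → Multiset T → Prop
  | nil (D : Multiset T) : NeighborPath D [] D
  | cons {D E D' : Multiset T} {r : T} {L : List T} (h : Neighbors D E r)
      (hL : NeighborPath E L D') : NeighborPath D (r :: L) D'

theorem neighborPath_cons_iff {T : Type*} {D D' : Multiset T} {r : T} {L : List T} :
    NeighborPath D (r :: L) D' ↔ ∃ E, Neighbors D E r ∧ NeighborPath E L D' := by
  constructor
  · rintro (_ | ⟨h, hL⟩)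
    exact ⟨_, h, hL⟩
  · rintro ⟨E, h, hL⟩
    exact .cons h hL

theorem Neighbors.exists_swap {T : Type*} {D E F : Multiset T} {r s : T}
    (hr : Neighbors D E r) (hs : Neighbors E F s) :
    ∃ E', Neighbors D E' s ∧ Neighbors E' F r := by
  rcases eq_or_ne r s with rfl | hrs
  · exact ⟨E, hr, hs⟩
  rcases hr with rfl | rfl <;> rcases hs with rfl | h
  · exact ⟨s ::ₘ D, .inl rfl, .inl (Multiset.cons_swap s r D)⟩
  · rcases Multiset.cons_eq_cons.1 h with ⟨h, -⟩ | ⟨-, C, rfl, rfl⟩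
    · exact absurd h hrs
    · exact ⟨C, .inr rfl, .inl rfl⟩
  · exact ⟨s ::ₘ r ::ₘ E, .inl rfl, .inr (Multiset.cons_swap s r E)⟩
  · subst h
    exact ⟨r ::ₘ F, .inr (Multiset.cons_swap r s F), .inr rfl⟩

theorem NeighborPath.perm {T : Type*} {L L' : List T} (h : L.Perm L') {D D' : Multiset T}
    (hL : NeighborPath D L D') : NeighborPath D L' D' := by
  induction h generalizing D with
  | nil => exact hL
  | cons r _ ih =>
    obtain ⟨E, hE, hL⟩ := neighborPath_cons_iff.1 hL
    exact .cons hE (ih hL)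
  | swap r s L =>
    obtain ⟨E, hE, hL⟩ := neighborPath_cons_iff.1 hL
    obtain ⟨F, hF, hL⟩ := neighborPath_cons_iff.1 hL
    obtain ⟨E', hE', hF'⟩ := hE.exists_swap hF
    exact .cons hE' (.cons hF' hL)
  | trans _ _ ih₁ ih₂ => exact ih₂ (ih₁ hL)

theorem neighborPath_ofFn {T : Type*} {J : ℕ} (D : Fin (J + 1) → Multiset T) (r : Fin J → T)
    (hD : ∀ j : Fin J, Neighbors (D j.castSucc) (D j.succ) (r j)) :
    NeighborPath (D 0) (List.ofFn r) (D (Fin.last J)) := by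
  induction J with
  | zero => simpa using NeighborPath.nil (D 0)
  | succ J ih =>
    rw [List.ofFn_succ]
    exact .cons (hD 0) (ih (fun j => D j.succ) (fun j => r j.succ) fun j => hD j.succ)

theorem renyiDiv_le_coe_iff {X : Type*} [MeasurableSpace X] {α : ℝ} (hα : 1 < α)
    {μ ν : Measure X} {c : ℝ} :
    renyiDiv α μ ν ≤ (c : EReal) ↔
      μ ≪ ν ∧ ∫⁻ x, μ.rnDeriv ν x ^ α ∂ν ≤ ENNReal.ofReal (Real.exp ((α - 1) * c)) := by
  have h0 : 0 < α - 1 := sub_pos.2 hα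
  unfold renyiDiv
  split_ifs with hac
  · simp only [hac, true_and]
    generalize ∫⁻ x, μ.rnDeriv ν x ^ α ∂ν = I
    have hlog : ENNReal.log (ENNReal.ofReal (Real.exp ((α - 1) * c)))
        = (((α - 1) * c : ℝ) : EReal) := by
      rw [ENNReal.log_ofReal_of_pos (Real.exp_pos _), Real.log_exp]
    rw [← ENNReal.log_le_log_iff, hlog]
    generalize ENNReal.log I = y
    induction y with
    | bot => simp [EReal.coe_mul_bot_of_pos (inv_pos.2 h0)]
    | top => simp [EReal.coe_mul_top_of_pos (inv_pos.2 h0), -EReal.coe_mul]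
    | coe y =>
      norm_cast
      rw [inv_mul_le_iff₀ h0]
  · simp [hac]

theorem renyiDiv_self_le {X : Type*} [MeasurableSpace X] {α : ℝ} (hα : 1 < α)
    (μ : Measure X) [IsProbabilityMeasure μ] : renyiDiv α μ μ ≤ ((0 : ℝ) : EReal) := by
  rw [renyiDiv_le_coe_iff hα]
  refine ⟨Measure.AbsolutelyContinuous.rfl, ?_⟩
  have h : ∫⁻ x, μ.rnDeriv μ x ^ α ∂μ = ∫⁻ _, 1 ∂μ :=
    lintegral_congr_ae <| by
      filter_upwards [μ.rnDeriv_self] with x hx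
      simp [hx]
  simp [h]

/-- Hölder's inequality for the Rényi integrals along `μ ≪ ν ≪ π`. -/
theorem lintegral_rnDeriv_rpow_le {X : Type*} [MeasurableSpace X] {α k : ℝ} (hα : 1 < α)
    (hk : 1 < k) {μ ν π : Measure X} [SigmaFinite μ] [SigmaFinite ν] [SigmaFinite π]
    (hμν : μ ≪ ν) (hνπ : ν ≪ π) :
    ∫⁻ x, μ.rnDeriv π x ^ α ∂π ≤
      (∫⁻ x, μ.rnDeriv ν x ^ ((k * α - 1) / (k - 1)) ∂ν) ^ (α * (k - 1) / (k * α - 1)) *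
        (∫⁻ x, ν.rnDeriv π x ^ (k * α) ∂π) ^ ((α - 1) / (k * α - 1)) := by
  have hα0 : 0 < α := by linarith
  have hα1 : 0 < α - 1 := sub_pos.2 hα
  have hk1 : 0 < k - 1 := sub_pos.2 hk
  have hkα : 0 < k * α - 1 := by nlinarith
  set f := μ.rnDeriv ν
  set g := ν.rnDeriv π
  have hf : Measurable f := Measure.measurable_rnDeriv μ ν
  have hg : Measurable g := Measure.measurable_rnDeriv ν π
  set p := (k * α - 1) / (α * (k - 1)) with hp
  set q := (k * α - 1) / (α - 1) with hq
  have hpq : p.HolderConjugate q := by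
    rw [Real.holderConjugate_iff]
    constructor
    · rw [hp, one_lt_div (by positivity)]
      linarith
    · rw [hp, hq]
      field_simp
      ring
  have hp0 : 0 < p := hpq.pos
  have hpα : 0 ≤ α - 1 / p := by
    have : 1 / p < 1 := by
      rw [div_lt_one hp0]
      exact hpq.lt
    linarith
  have hαp : α * p = (k * α - 1) / (k - 1) := by
    rw [hp]
    field_simp
  have hip : 1 / p = α * (k - 1) / (k * α - 1) := by rw [hp, one_div_div]
  have hαq : (α - 1 / p) * q = k * α := by
    have h : α - 1 / p = k * α * (α - 1) / (k * α - 1) := by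
      rw [hip, eq_div_iff hkα.ne', sub_mul, div_mul_cancel₀ _ hkα.ne']
      ring
    rw [h, hq]
    field_simp
  have hiq : 1 / q = (α - 1) / (k * α - 1) := by rw [hq, one_div_div]
  calc ∫⁻ x, μ.rnDeriv π x ^ α ∂π
      = ∫⁻ x, ((fun x => f x ^ α * g x ^ (1 / p)) * fun x => g x ^ (α - 1 / p)) x ∂π := by
        refine lintegral_congr_ae ?_
        filter_upwards [Measure.rnDeriv_mul_rnDeriv (κ := π) hμν] with x hx
        rw [← hx]
        simp only [Pi.mul_apply]
        rw [ENNReal.mul_rpow_of_nonneg _ _ hα0.le, mul_assoc,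
          ← ENNReal.rpow_add_of_nonneg _ _ (by positivity) hpα, add_sub_cancel]
    _ ≤ (∫⁻ x, (f x ^ α * g x ^ (1 / p)) ^ p ∂π) ^ (1 / p) *
          (∫⁻ x, (g x ^ (α - 1 / p)) ^ q ∂π) ^ (1 / q) :=
        ENNReal.lintegral_mul_le_Lp_mul_Lq π hpq (by fun_prop) (by fun_prop)
    _ = _ := by
        have h (x : X) : (f x ^ α * g x ^ (1 / p)) ^ p = g x * f x ^ ((k * α - 1) / (k - 1)) := by
          rw [ENNReal.mul_rpow_of_nonneg _ _ hp0.le, ← ENNReal.rpow_mul, ← ENNReal.rpow_mul, hαp,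
            one_div_mul_cancel hp0.ne', ENNReal.rpow_one, mul_comm]
        simp_rw [h, ← ENNReal.rpow_mul, hαq]
        rw [lintegral_rnDeriv_mul hνπ (by fun_prop), hip, hiq]

/-- Weak triangle inequality for the Rényi divergence. -/
theorem renyiDiv_le_add {X : Type*} [MeasurableSpace X] {α k a b : ℝ} (hα : 1 < α) (hk : 1 < k)
    {μ ν π : Measure X} [SigmaFinite μ] [SigmaFinite ν] [SigmaFinite π]
    (hμν : renyiDiv ((k * α - 1) / (k - 1)) μ ν ≤ (a : EReal))
    (hνπ : renyiDiv (k * α) ν π ≤ (b : EReal)) :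
    renyiDiv α μ π ≤ ((k * α / (k * α - 1) * a + b : ℝ) : EReal) := by
  have hα1 : 0 < α - 1 := sub_pos.2 hα
  have hk1 : 0 < k - 1 := sub_pos.2 hk
  have hkα : 0 < k * α - 1 := by nlinarith
  have hβ : 1 < (k * α - 1) / (k - 1) := by
    rw [one_lt_div hk1]
    nlinarith
  rw [renyiDiv_le_coe_iff hβ] at hμν
  rw [renyiDiv_le_coe_iff (by linarith)] at hνπ
  rw [renyiDiv_le_coe_iff hα]
  refine ⟨hμν.1.trans hνπ.1, (lintegral_rnDeriv_rpow_le hα hk hμν.1 hνπ.1).trans ?_⟩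
  have hp : 0 ≤ α * (k - 1) / (k * α - 1) := by positivity
  have hq : 0 ≤ (α - 1) / (k * α - 1) := by positivity
  refine (mul_le_mul' (ENNReal.rpow_le_rpow hμν.2 hp) (ENNReal.rpow_le_rpow hνπ.2 hq)).trans_eq ?_
  rw [ENNReal.ofReal_rpow_of_pos (Real.exp_pos _), ENNReal.ofReal_rpow_of_pos (Real.exp_pos _),
    ← ENNReal.ofReal_mul (by positivity), ← Real.exp_mul, ← Real.exp_mul, ← Real.exp_add]
  congr 2
  field_simp
  ring

theorem PRzCDP.renyiDiv_le_of_neighborPath {T Y : Type*} [MeasurableSpace Y] {P : T → ℝ}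
    {M : Multiset T → Measure Y} [∀ D, IsProbabilityMeasure (M D)] (hM : PRzCDP M P)
    {k : ℝ} (hk : 1 < k) {J : ℕ} (r : Fin J → T) {D D' : Multiset T}
    (hD : NeighborPath D (List.ofFn r) D') {α : ℝ} (hα : 1 < α) :
    renyiDiv α (M D) (M D') ≤
      ((α * ∑ j : Fin J, k ^ ((j : ℕ) + 1) / (k - 1) * P (r j) : ℝ) : EReal) := by
  induction J generalizing D α with
  | zero =>
    rw [List.ofFn_zero] at hD
    obtain ⟨⟩ := hD
    simpa using renyiDiv_self_le hα (M _)
  | succ J ih =>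
    rw [List.ofFn_succ, neighborPath_cons_iff] at hD
    obtain ⟨E, hE, hD⟩ := hD
    have hα0 : 0 < α := by linarith
    have hk1 : 0 < k - 1 := sub_pos.2 hk
    have hkα : 1 < k * α := by nlinarith
    have hkα' : 0 < k * α - 1 := sub_pos.2 hkα
    have hβ : 1 < (k * α - 1) / (k - 1) := by
      rw [one_lt_div hk1]
      nlinarith
    refine (renyiDiv_le_add hα hk (hM _ hβ D E (r 0) hE) (ih _ hD hkα)).trans_eq ?_
    congr 1
    have hsum : ∑ j : Fin J, k ^ ((j.succ : ℕ) + 1) / (k - 1) * P (r j.succ) =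
        k * ∑ j : Fin J, k ^ ((j : ℕ) + 1) / (k - 1) * P (r j.succ) := by
      rw [Finset.mul_sum]
      refine Finset.sum_congr rfl fun j _ => ?_
      rw [Fin.val_succ]
      ring
    rw [Fin.sum_univ_succ, hsum]
    simp only [Fin.val_zero, zero_add, pow_one]
    field_simp

/-- Advanced group privacy for P-PRzCDP (Lemma 5). -/
theorem przcdp_advanced_group_privacy {T Y : Type*} [MeasurableSpace Y]
    (P : T → ℝ) (hP : ∀ r, 0 ≤ P r)
    (M : Multiset T → Measure Y) (hMprob : ∀ D, IsProbabilityMeasure (M D))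
    (hM : PRzCDP M P) (J : ℕ) (hJ : 1 ≤ J)
    (D : Fin (J + 1) → Multiset T) (r : Fin J → T)
    (hD : ∀ j : Fin J, Neighbors (D j.castSucc) (D j.succ) (r j))
    (σ : Equiv.Perm (Fin J))
    (hσ : ∀ i j : Fin J, i ≤ j → P (r (σ j)) ≤ P (r (σ i))) :
    ∀ α : ℝ, 1 < α →
      renyiDiv α (M (D 0)) (M (D (Fin.last J))) ≤
        ((α * ⨅ k : Set.Ioi (1 : ℝ),
          ∑ j : Fin J, (k : ℝ) ^ ((j : ℕ) + 1) / ((k : ℝ) - 1) * P (r (σ j)) : ℝ) : EReal) := by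
  intro α hα
  have hα0 : 0 < α := by linarith
  have hpath : NeighborPath (D 0) (List.ofFn fun j => r (σ j)) (D (Fin.last J)) :=
    (neighborPath_ofFn D r hD).perm (Equiv.Perm.ofFn_comp_perm σ r).symm
  have hle (k : Set.Ioi (1 : ℝ)) := hM.renyiDiv_le_of_neighborPath k.2 _ hpath hα
  have : Nonempty (Set.Ioi (1 : ℝ)) := ⟨⟨2, by norm_num⟩⟩
  generalize renyiDiv α (M (D 0)) (M (D (Fin.last J))) = d at hle ⊢
  induction d with
  | bot => exact bot_le
  | top => exact absurd (hle ⟨2, by norm_num⟩) (EReal.coe_lt_top _).not_ge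
  | coe d =>
    simp only [EReal.coe_le_coe_iff] at hle ⊢
    rw [← div_le_iff₀' hα0]
    exact le_ciInf fun k => (div_le_iff₀' hα0).2 (hle k)
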